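/- arXiv:1904.03118 — 3 statements merged into one kernel-verified Lean document; each statement's English description precedes it below -/
import Mathlib

section
/- Let U and V be real separable Hilbert spaces, (T(t))_{t≥0} a strongly continuous semigroup of bounded linear operators on V, B : U → V a bounded linear operator, S > 0, and M a positive integer. Let Ψ : U → ℂ be a function such that s ↦ Ψ(B*T(s)*v) is Lebesgue integrable on [0,S] for every v ∈ V, where B* and T(s)* denote Hilbert-space adjoints. Suppose θ is a Borel probability measure on V whose characteristic function satisfies φ_θ(v) = exp(∫₀^{S/M} Ψ(B*T(s)*v) ds) for all v ∈ V. Define λ_i := θ ∘ T(iS/M)⁻¹ for i = 0, …, M−1 and λ := λ_0 ∗ λ_1 ∗ ⋯ ∗ λ_{M−1}. Then φ_λ(v) = exp(∫₀^S Ψ(B*T(s)*v) ds) for all v ∈ V. -/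
open MeasureTheory Filter Topology
open scoped RealInnerProductSpace MeasureTheory

theorem isProbabilityMeasure_foldr_conv {ι : Type*} {V : Type*} [NormedAddCommGroup V]
    [SecondCountableTopology V] [MeasurableSpace V] [BorelSpace V]
    (μ : ι → Measure V) [∀ i, IsProbabilityMeasure (μ i)] (l : List ι) :
    IsProbabilityMeasure (l.foldr (fun i acc => μ i ∗ acc) (Measure.dirac (0 : V))) := by
  induction l with
  | nil => simp only [List.foldr_nil]; infer_instance
  | cons i l ih => simp only [List.foldr_cons]; infer_instance

section

variable {V : Type*} [NormedAddCommGroup V] [InnerProductSpace ℝ V]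
  [MeasurableSpace V] [BorelSpace V]

theorem charFun_map_clm [CompleteSpace V] (θ : Measure V) (A : V →L[ℝ] V) (v : V) :
    charFun (θ.map A) v = charFun θ (ContinuousLinearMap.adjoint A v) := by
  rw [charFun_apply, charFun_apply, integral_map (by fun_prop)
    (by exact (Continuous.measurable (by fun_prop)).aestronglyMeasurable)]
  simp_rw [ContinuousLinearMap.adjoint_inner_right]

variable [SecondCountableTopology V]

theorem charFun_foldr_conv {ι : Type*} (μ : ι → Measure V)
    [∀ i, IsProbabilityMeasure (μ i)] (l : List ι) (v : V) :
    charFun (l.foldr (fun i acc => μ i ∗ acc) (Measure.dirac (0 : V))) v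
      = (l.map fun i => charFun (μ i) v).prod := by
  induction l with
  | nil => simp [charFun_dirac]
  | cons i l ih =>
    have := isProbabilityMeasure_foldr_conv μ l
    simp only [List.foldr_cons, List.map_cons, List.prod_cons, charFun_conv, ih]

end

/-- The characteristic function of the finite convolution
`λ = (θ ∘ T(0·S/M)⁻¹) ∗ ⋯ ∗ (θ ∘ T((M-1)·S/M)⁻¹)` equals
`exp (∫₀^S Ψ(B* T(s)* v) ds)` whenever `θ` has characteristic function
`exp (∫₀^{S/M} Ψ(B* T(s)* v) ds)`. -/
theorem stmt0
    {U V : Type*}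
    [NormedAddCommGroup U] [InnerProductSpace ℝ U] [CompleteSpace U] [SecondCountableTopology U]
    [NormedAddCommGroup V] [InnerProductSpace ℝ V] [CompleteSpace V] [SecondCountableTopology V]
    [MeasurableSpace V] [BorelSpace V]
    (T : ℝ → V →L[ℝ] V)
    (hT0 : T 0 = ContinuousLinearMap.id ℝ V)
    (hTadd : ∀ s t : ℝ, 0 ≤ s → 0 ≤ t → T (s + t) = (T s).comp (T t))
    (hTcont : ∀ v : V, ContinuousOn (fun t => T t v) (Set.Ici (0 : ℝ)))
    (B : U →L[ℝ] V)
    (S : ℝ) (hS : 0 < S) (M : ℕ) (hM : 0 < M)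
    (Ψ : U → ℂ)
    (hΨint : ∀ v : V, IntervalIntegrable
      (fun s => Ψ (ContinuousLinearMap.adjoint B (ContinuousLinearMap.adjoint (T s) v)))
      volume 0 S)
    (θ : Measure V) [IsProbabilityMeasure θ]
    (hθ : ∀ v : V, (∫ h, Complex.exp (Complex.I * (⟪h, v⟫ : ℂ)) ∂θ)
      = Complex.exp (∫ s in (0:ℝ)..(S / M),
          Ψ (ContinuousLinearMap.adjoint B (ContinuousLinearMap.adjoint (T s) v))))
    (lam : Measure V)
    (hlam : lam = (List.range M).foldr
      (fun i acc => (θ.map (T ((i : ℝ) * S / M))) ∗ acc) (Measure.dirac (0 : V))) :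
    ∀ v : V, (∫ h, Complex.exp (Complex.I * (⟪h, v⟫ : ℂ)) ∂lam)
      = Complex.exp (∫ s in (0:ℝ)..S,
          Ψ (ContinuousLinearMap.adjoint B (ContinuousLinearMap.adjoint (T s) v))) := by
  have hchar (μ : Measure V) (w : V) :
      ∫ h, Complex.exp (Complex.I * (⟪h, w⟫ : ℂ)) ∂μ = charFun μ w := by
    simp only [charFun_apply, mul_comm]
  simp only [hchar] at hθ ⊢
  intro v
  have hM' : (0 : ℝ) < M := by exact_mod_cast hM
  have hprob (r : ℝ) : IsProbabilityMeasure (θ.map (T (r * S / M))) :=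
    Measure.isProbabilityMeasure_map (by fun_prop)
  rw [hlam, charFun_foldr_conv (fun r : ℝ => θ.map (T (r * S / M)))]
  set f : ℝ → ℂ := fun s =>
    Ψ (ContinuousLinearMap.adjoint B (ContinuousLinearMap.adjoint (T s) v)) with hf
  have hshift (i : ℕ) : charFun (θ.map (T ((i : ℝ) * S / M))) v
      = Complex.exp (∫ s in ((i : ℝ) * S / M)..(((i + 1 : ℕ) : ℝ) * S / M), f s) := by
    rw [charFun_map_clm, hθ]
    congr 1
    have hcomp : ∫ s in (0 : ℝ)..(S / M), f (s + (i : ℝ) * S / M)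
        = ∫ s in ((i : ℝ) * S / M)..(((i + 1 : ℕ) : ℝ) * S / M), f s := by
      rw [intervalIntegral.integral_comp_add_right f]
      congr 1 <;> push_cast <;> ring
    rw [← hcomp]
    refine intervalIntegral.integral_congr fun s hs => ?_
    rw [Set.uIcc_of_le (by positivity)] at hs
    simp only [hf]
    rw [add_comm, hTadd _ _ (by positivity) hs.1, ContinuousLinearMap.adjoint_comp]
    rfl
  have hint (k : ℕ) (hk : k < M) : IntervalIntegrable f volume
      ((k : ℝ) * S / M) (((k + 1 : ℕ) : ℝ) * S / M) := by
    have hk' : ((k + 1 : ℕ) : ℝ) ≤ M := by exact_mod_cast hk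
    refine (hΨint v).mono_set ?_
    rw [Set.uIcc_of_le (by gcongr; simp), Set.uIcc_of_le hS.le]
    refine Set.Icc_subset_Icc (by positivity) ?_
    rw [div_le_iff₀ hM', mul_comm S]
    gcongr
  have hsum := intervalIntegral.sum_integral_adjacent_intervals
    (a := fun i : ℕ => (i : ℝ) * S / M) hint
  simp only [Nat.cast_zero, zero_mul, zero_div, mul_div_cancel_left₀ S hM'.ne'] at hsum
  rw [← hsum, Complex.exp_sum]
  simp only [← hshift, List.bind_eq_flatMap, List.pure_def, ← List.map_eq_flatMap, List.map_map]
  rfl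
end

section
/- Let U and V be real separable Hilbert spaces, (T(t))_{t≥0} a strongly continuous semigroup of bounded linear operators on V, B : U → V a bounded linear operator, and Ψ : U → ℂ a function such that s ↦ Ψ(B*T(s)*v) is Lebesgue integrable on [0,t] for every v ∈ V and t ≥ 0. Suppose (ν_t)_{t≥0} is a family of Borel probability measures on V whose characteristic functions satisfy φ_{ν_t}(v) = exp(∫₀^t Ψ(B*T(s)*v) ds) for all v ∈ V and t ≥ 0. Then ν_{t+s} = (ν_s ∘ T(t)⁻¹) ∗ ν_t for all s, t ≥ 0. -/
open MeasureTheory Filter Topology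
open scoped RealInnerProductSpace MeasureTheory

/-- If `(ν_t)` are probability measures with characteristic functions
`φ_{ν_t}(v) = exp (∫₀^t Ψ(B* T(s)* v) ds)`, then they form a skew-convolution semigroup:
`ν_{t+s} = (ν_s ∘ T(t)⁻¹) ∗ ν_t`. -/
theorem stmt1
    {U V : Type*}
    [NormedAddCommGroup U] [InnerProductSpace ℝ U] [CompleteSpace U] [SecondCountableTopology U]
    [NormedAddCommGroup V] [InnerProductSpace ℝ V] [CompleteSpace V] [SecondCountableTopology V]
    [MeasurableSpace V] [BorelSpace V]
    (T : ℝ → V →L[ℝ] V)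
    (hT0 : T 0 = ContinuousLinearMap.id ℝ V)
    (hTadd : ∀ s t : ℝ, 0 ≤ s → 0 ≤ t → T (s + t) = (T s).comp (T t))
    (hTcont : ∀ v : V, ContinuousOn (fun t => T t v) (Set.Ici (0 : ℝ)))
    (B : U →L[ℝ] V)
    (Ψ : U → ℂ)
    (hΨint : ∀ v : V, ∀ t : ℝ, 0 ≤ t → IntervalIntegrable
      (fun s => Ψ (ContinuousLinearMap.adjoint B (ContinuousLinearMap.adjoint (T s) v)))
      volume 0 t)
    (ν : ℝ → Measure V) (hprob : ∀ t : ℝ, IsProbabilityMeasure (ν t))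
    (hchar : ∀ v : V, ∀ t : ℝ, 0 ≤ t →
      (∫ h, Complex.exp (Complex.I * (⟪h, v⟫ : ℂ)) ∂(ν t))
        = Complex.exp (∫ s in (0:ℝ)..t,
            Ψ (ContinuousLinearMap.adjoint B (ContinuousLinearMap.adjoint (T s) v)))) :
    ∀ s t : ℝ, 0 ≤ s → 0 ≤ t → ν (t + s) = ((ν s).map (T t)) ∗ (ν t) := by
  intro s t hs ht
  have hchar' : ∀ v : V, ∀ r : ℝ, 0 ≤ r → charFun (ν r) v
      = Complex.exp (∫ x in (0:ℝ)..r,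
          Ψ (ContinuousLinearMap.adjoint B (ContinuousLinearMap.adjoint (T x) v))) := by
    intro v r hr
    rw [← hchar v r hr, charFun_apply]
    simp_rw [mul_comm Complex.I]
  have : IsProbabilityMeasure ((ν s).map (T t)) :=
    Measure.isProbabilityMeasure_map (T t).measurable.aemeasurable
  refine Measure.ext_of_charFun (funext fun v => ?_)
  have hmap : charFun ((ν s).map (T t)) v
      = charFun (ν s) (ContinuousLinearMap.adjoint (T t) v) := by
    rw [charFun_apply, charFun_apply,
      integral_map (T t).measurable.aemeasurable (by fun_prop)]
    simp_rw [ContinuousLinearMap.adjoint_inner_right]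
  have hint_ts := hΨint v (t + s) (add_nonneg ht hs)
  have hshift : ∫ x in (0:ℝ)..s, Ψ (ContinuousLinearMap.adjoint B
        (ContinuousLinearMap.adjoint (T x) (ContinuousLinearMap.adjoint (T t) v)))
      = ∫ x in t..(t + s),
        Ψ (ContinuousLinearMap.adjoint B (ContinuousLinearMap.adjoint (T x) v)) := by
    have hsub := intervalIntegral.integral_comp_add_left (a := 0) (b := s) (fun x =>
      Ψ (ContinuousLinearMap.adjoint B (ContinuousLinearMap.adjoint (T x) v))) t
    rw [add_zero] at hsub
    rw [← hsub]
    refine intervalIntegral.integral_congr fun x hx => ?_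
    rw [Set.uIcc_of_le hs] at hx
    simp only [hTadd t x ht hx.1, ContinuousLinearMap.adjoint_comp,
      ContinuousLinearMap.comp_apply]
  rw [charFun_conv, hmap, hchar' _ _ (add_nonneg ht hs), hchar' _ _ hs, hchar' _ _ ht,
    hshift, ← Complex.exp_add, ← intervalIntegral.integral_add_adjacent_intervals (hΨint v t ht)
      ((hΨint v t ht).symm.trans hint_ts), add_comm]
end

section
/- Let V be a real separable Hilbert space, (T(t))_{t≥0} a semigroup of bounded linear operators on V (T(0) = Id and T(t+s) = T(t)T(s)), and (ν_t)_{t≥0} a skew-convolution semigroup with respect to (T(t))_{t≥0}, i.e. ν_{t+s} = T_tν_s ∗ ν_t for all s,t ≥ 0. Suppose that ν_t converges weakly to a Borel probability measure ν as t → ∞, and that the characteristic functions of ν and of every ν_t vanish nowhere on V. Then every stationary measure λ (i.e. every Borel probability measure λ with λ = T_tλ ∗ ν_t for all t ≥ 0) has the form λ = β ∗ ν, where β is a Borel probability measure on V satisfying β = T_tβ for all t ≥ 0; moreover T_tλ converges weakly to β as t → ∞. -/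
open MeasureTheory Filter Topology
open scoped RealInnerProductSpace MeasureTheory

namespace MeasureTheory

/-- If all convolutions `μ i ∗ ν i` and all `ν i` belong to tight families of probability measures,
then so do all `μ i`. -/
lemma isTightMeasureSet_range_of_conv
    {E : Type*} [NormedAddCommGroup E] [SecondCountableTopology E]
    [MeasurableSpace E] [BorelSpace E] {ι : Type*} {μ ν : ι → Measure E}
    [∀ i, IsProbabilityMeasure (μ i)] [∀ i, IsProbabilityMeasure (ν i)]
    (hν : IsTightMeasureSet (Set.range ν))
    (hμν : IsTightMeasureSet (Set.range fun i => μ i ∗ ν i)) :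
    IsTightMeasureSet (Set.range μ) := by
  rw [isTightMeasureSet_iff_exists_isCompact_measure_compl_le] at hν hμν ⊢
  simp only [Set.forall_mem_range] at hν hμν ⊢
  intro ε hε
  obtain ⟨K, hK, hKle⟩ := hμν (ε / 2) (ENNReal.half_pos hε.ne')
  obtain ⟨L, hL, hLle⟩ := hν 2⁻¹ (by simp)
  have hKL : IsCompact ((fun p : E × E => p.1 - p.2) '' (K ×ˢ L)) :=
    (hK.prod hL).image (by fun_prop)
  refine ⟨_, hKL, fun i => ?_⟩
  set C := (fun p : E × E => p.1 - p.2) '' (K ×ˢ L)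
  have hνL : 2⁻¹ ≤ ν i L := by
    have h := prob_add_prob_compl (μ := ν i) hL.measurableSet
    have h2 : (1 : ENNReal) ≤ ν i L + 2⁻¹ := by
      rw [← h]
      gcongr
      exact hLle i
    rw [← ENNReal.inv_two_add_inv_two] at h2
    exact (ENNReal.add_le_add_iff_right (by simp)).1 h2
  have hsub : Cᶜ ×ˢ L ⊆ (fun p : E × E => p.1 + p.2) ⁻¹' Kᶜ := by
    rintro ⟨x, y⟩ ⟨hx, hy⟩ hxy
    exact hx ⟨(x + y, y), ⟨hxy, hy⟩, by simp⟩
  have hmul : μ i Cᶜ * 2⁻¹ ≤ ε / 2 := calc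
    μ i Cᶜ * 2⁻¹ ≤ μ i Cᶜ * ν i L := by gcongr
    _ = ((μ i).prod (ν i)) (Cᶜ ×ˢ L) := (Measure.prod_prod _ _).symm
    _ ≤ ((μ i).prod (ν i)) ((fun p : E × E => p.1 + p.2) ⁻¹' Kᶜ) := measure_mono hsub
    _ = (μ i ∗ ν i) Kᶜ := by
      rw [Measure.conv, Measure.map_apply (by fun_prop) hK.measurableSet.compl]
    _ ≤ ε / 2 := hKle i
  rw [ENNReal.div_eq_inv_mul, mul_comm] at hmul
  exact (ENNReal.mul_le_mul_iff_right (by simp) (by simp)).1 hmul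

/-- A weakly convergent sequence of probability measures on a Polish metric space is tight. -/
lemma ProbabilityMeasure.isTightMeasureSet_range_of_tendsto
    {E : Type*} [MetricSpace E] [CompleteSpace E] [SecondCountableTopology E]
    [MeasurableSpace E] [BorelSpace E] {ν : ℕ → ProbabilityMeasure E} {ν₀ : ProbabilityMeasure E}
    (h : Tendsto ν atTop (𝓝 ν₀)) :
    IsTightMeasureSet (Set.range fun n => (ν n : Measure E)) := by
  have hcpt : IsCompact (closure (Set.range ν)) :=
    h.isCompact_insert_range.closure_of_subset (Set.subset_insert _ _)
  refine (isTightMeasureSet_of_isCompact_closure hcpt).subset ?_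
  rintro _ ⟨n, rfl⟩
  exact ⟨ν n, ⟨n, rfl⟩, rfl⟩

/-- Convergence of the integrals of all bounded continuous functions, in unbundled form. -/
lemma ProbabilityMeasure.tendsto_iff_forall_bounded_integral_tendsto
    {V : Type*} [TopologicalSpace V] [MeasurableSpace V] [BorelSpace V] {ι : Type*} {l : Filter ι}
    {μ : ι → ProbabilityMeasure V} {μ₀ : ProbabilityMeasure V} :
    Tendsto μ l (𝓝 μ₀) ↔ ∀ f : V → ℝ, Continuous f → (∃ C : ℝ, ∀ x : V, |f x| ≤ C) →
      Tendsto (fun i => ∫ v, f v ∂(μ i : Measure V)) l (𝓝 (∫ v, f v ∂(μ₀ : Measure V))) := by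
  rw [ProbabilityMeasure.tendsto_iff_forall_integral_tendsto]
  refine ⟨fun h f hf ⟨C, hC⟩ => ?_, fun h f => ?_⟩
  · exact h (BoundedContinuousFunction.ofNormedAddCommGroup f hf C hC)
  · exact h f f.continuous ⟨‖f‖, f.norm_coe_le_norm⟩

lemma ProbabilityMeasure.tendsto_charFun
    {V : Type*} [NormedAddCommGroup V] [InnerProductSpace ℝ V] [MeasurableSpace V] [BorelSpace V]
    {ι : Type*} {l : Filter ι}
    {μ : ι → ProbabilityMeasure V} {μ₀ : ProbabilityMeasure V} (h : Tendsto μ l (𝓝 μ₀)) (v : V) :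
    Tendsto (fun i => charFun (μ i : Measure V) v) l (𝓝 (charFun (μ₀ : Measure V) v)) := by
  rw [ProbabilityMeasure.tendsto_iff_forall_integral_rclike_tendsto ℂ] at h
  simp_rw [charFun_eq_integral_innerProbChar]
  exact h _

section Hilbert

variable {V : Type*} [NormedAddCommGroup V] [InnerProductSpace ℝ V] [CompleteSpace V]
  [SecondCountableTopology V] [MeasurableSpace V] [BorelSpace V]

/-- Weak limits can be taken on both sides of a constant convolution. -/
lemma ProbabilityMeasure.eq_conv_of_tendsto {ι : Type*} {l : Filter ι} [l.NeBot]
    {lam : Measure V} [IsProbabilityMeasure lam]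
    {μ ν : ι → ProbabilityMeasure V} {μ₀ ν₀ : ProbabilityMeasure V}
    (hlam : ∀ i, lam = (μ i : Measure V) ∗ (ν i : Measure V))
    (hμ : Tendsto μ l (𝓝 μ₀)) (hν : Tendsto ν l (𝓝 ν₀)) :
    lam = (μ₀ : Measure V) ∗ (ν₀ : Measure V) := by
  refine Measure.ext_of_charFun (funext fun v => ?_)
  rw [charFun_conv]
  refine tendsto_nhds_unique ?_ ((tendsto_charFun hμ v).mul (tendsto_charFun hν v))
  simp_rw [← charFun_conv, ← hlam]
  exact tendsto_const_nhds

/-- Convolution with a measure whose characteristic function vanishes nowhere is injective. -/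
lemma ProbabilityMeasure.conv_right_cancel {β β' ν : ProbabilityMeasure V}
    (hν : ∀ v, charFun (ν : Measure V) v ≠ 0)
    (h : (β : Measure V) ∗ (ν : Measure V) = (β' : Measure V) ∗ (ν : Measure V)) : β = β' := by
  refine ProbabilityMeasure.toMeasure_injective (Measure.ext_of_charFun (funext fun v => ?_))
  have hv := congrArg (fun m => charFun m v) h
  simp only [charFun_conv] at hv
  exact mul_right_cancel₀ (hν v) hv

/-- If `lam = μ n ∗ ν n` for all `n` and `ν n` converges weakly to a measure whose characteristic
function vanishes nowhere, then `μ n` converges weakly as well. -/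
lemma ProbabilityMeasure.exists_tendsto_of_conv_eq
    {lam : Measure V} [IsProbabilityMeasure lam]
    {μ ν : ℕ → ProbabilityMeasure V} {ν₀ : ProbabilityMeasure V}
    (hlam : ∀ n, lam = (μ n : Measure V) ∗ (ν n : Measure V))
    (hν : Tendsto ν atTop (𝓝 ν₀)) (hφ : ∀ v, charFun (ν₀ : Measure V) v ≠ 0) :
    ∃ β : ProbabilityMeasure V, Tendsto μ atTop (𝓝 β) := by
  have htight : IsTightMeasureSet (Set.range fun n => (μ n : Measure V)) := by
    refine isTightMeasureSet_range_of_conv (ν := fun n => (ν n : Measure V))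
      (isTightMeasureSet_range_of_tendsto hν) ?_
    simp_rw [← hlam, Set.range_const]
    exact isTightMeasureSet_singleton
  have hcpt : IsCompact (closure (Set.range μ)) := by
    refine isCompact_closure_of_isTightMeasureSet (htight.subset ?_)
    rintro _ ⟨_, ⟨n, rfl⟩, rfl⟩
    exact ⟨n, rfl⟩
  have hmem : ∀ n, μ n ∈ closure (Set.range μ) := fun n => subset_closure ⟨n, rfl⟩
  have hcluster : ∀ β, MapClusterPt β atTop μ → lam = (β : Measure V) ∗ (ν₀ : Measure V) := by
    intro β hβ
    obtain ⟨U, hU, hUβ⟩ := mapClusterPt_iff_ultrafilter.1 hβ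
    exact eq_conv_of_tendsto hlam hUβ (hν.mono_left hU)
  obtain ⟨β, -, hβ⟩ := hcpt.exists_mapClusterPt (f := atTop) (u := μ)
    (tendsto_principal.2 (Eventually.of_forall hmem))
  refine ⟨β, hcpt.tendsto_nhds_of_unique_mapClusterPt (Eventually.of_forall hmem)
    fun β' _ hβ' => ?_⟩
  exact conv_right_cancel hφ ((hcluster β' hβ').symm.trans (hcluster β hβ))

end Hilbert

end MeasureTheory

/-- Suppose `(ν_t)` is a skew-convolution semigroup with respect to the semigroup `(T(t))`,
`ν_t → ν` weakly as `t → ∞`, and the characteristic functions of `ν` and of every `ν_t` vanish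
nowhere. Then every stationary measure `λ` has the form `λ = β ∗ ν` with `β` a probability
measure satisfying `β = T_tβ` for all `t ≥ 0`, and `T_tλ → β` weakly as `t → ∞`. -/
theorem stmt5
    {V : Type*}
    [NormedAddCommGroup V] [InnerProductSpace ℝ V] [CompleteSpace V] [SecondCountableTopology V]
    [MeasurableSpace V] [BorelSpace V]
    (T : ℝ → V →L[ℝ] V)
    (hT0 : T 0 = ContinuousLinearMap.id ℝ V)
    (hTadd : ∀ s t : ℝ, 0 ≤ s → 0 ≤ t → T (s + t) = (T s).comp (T t))
    (ν : ℝ → Measure V) (hprob : ∀ t : ℝ, IsProbabilityMeasure (ν t))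
    (hskew : ∀ s t : ℝ, 0 ≤ s → 0 ≤ t → ν (t + s) = ((ν s).map (T t)) ∗ (ν t))
    (νlim : Measure V) [IsProbabilityMeasure νlim]
    (hconv : ∀ f : V → ℝ, Continuous f → (∃ C : ℝ, ∀ x : V, |f x| ≤ C) →
      Tendsto (fun t : ℝ => ∫ v, f v ∂(ν t)) atTop (𝓝 (∫ v, f v ∂νlim)))
    (hφlim : ∀ v : V, (∫ h, Complex.exp (Complex.I * (⟪h, v⟫ : ℂ)) ∂νlim) ≠ 0)
    (hφν : ∀ t : ℝ, 0 ≤ t → ∀ v : V,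
      (∫ h, Complex.exp (Complex.I * (⟪h, v⟫ : ℂ)) ∂(ν t)) ≠ 0)
    (lam : Measure V) [IsProbabilityMeasure lam]
    (hstat : ∀ t : ℝ, 0 ≤ t → lam = (lam.map (T t)) ∗ (ν t)) :
    ∃ β : Measure V, IsProbabilityMeasure β ∧
      (∀ t : ℝ, 0 ≤ t → β = β.map (T t)) ∧
      lam = β ∗ νlim ∧
      (∀ f : V → ℝ, Continuous f → (∃ C : ℝ, ∀ x : V, |f x| ≤ C) →
        Tendsto (fun t : ℝ => ∫ v, f v ∂(lam.map (T t))) atTop (𝓝 (∫ v, f v ∂β))) := by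
  let P : ℝ → ProbabilityMeasure V := fun t => ⟨ν t, hprob t⟩
  let P₀ : ProbabilityMeasure V := ⟨νlim, inferInstance⟩
  let Λ : ProbabilityMeasure V := ⟨lam, inferInstance⟩
  let M : ℝ → ProbabilityMeasure V := fun t => Λ.map (T t).continuous.measurable.aemeasurable
  have hP : Tendsto P atTop (𝓝 P₀) :=
    ProbabilityMeasure.tendsto_iff_forall_bounded_integral_tendsto.2 hconv
  have hφ : ∀ v, charFun (P₀ : Measure V) v ≠ 0 := by
    intro v
    have h := hφlim v
    simp_rw [mul_comm Complex.I] at h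
    exact h
  have hM : ∀ t, 0 ≤ t → lam = (M t : Measure V) ∗ (P t : Measure V) := hstat
  have key : ∀ u : ℕ → ℝ, Tendsto u atTop atTop → ∃ β : ProbabilityMeasure V,
      Tendsto (fun n => M (u n)) atTop (𝓝 β) ∧ lam = (β : Measure V) ∗ (P₀ : Measure V) := by
    intro u hu
    have hu' : Tendsto (fun n => max (u n) 0) atTop atTop :=
      tendsto_atTop_mono (fun n => le_max_left _ _) hu
    have hlam := fun n => hM (max (u n) 0) (le_max_right _ _)
    obtain ⟨β, hβ⟩ := ProbabilityMeasure.exists_tendsto_of_conv_eq hlam (hP.comp hu') hφ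
    refine ⟨β, hβ.congr' ?_, ProbabilityMeasure.eq_conv_of_tendsto hlam hβ (hP.comp hu')⟩
    filter_upwards [hu.eventually_ge_atTop 0] with n hn
    rw [max_eq_left hn]
  obtain ⟨β, -, hβlam⟩ := key (fun n => (n : ℝ)) tendsto_natCast_atTop_atTop
  have hMβ : Tendsto M atTop (𝓝 β) := by
    refine tendsto_of_seq_tendsto fun u hu => ?_
    obtain ⟨β', hβ', hβ'lam⟩ := key u hu
    rwa [ProbabilityMeasure.conv_right_cancel hφ (hβlam.symm.trans hβ'lam)]
  refine ⟨β, inferInstance, fun t ht => ?_, hβlam,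
    ProbabilityMeasure.tendsto_iff_forall_bounded_integral_tendsto.1 hMβ⟩
  have hmap := ProbabilityMeasure.tendsto_map_of_tendsto_of_continuous M β hMβ (T t).continuous
  have hshift : Tendsto (fun s => M (t + s)) atTop (𝓝 β) :=
    hMβ.comp (tendsto_atTop_add_const_left _ t tendsto_id)
  have heq : (fun s => (M s).map (T t).continuous.measurable.aemeasurable) =ᶠ[atTop]
      fun s => M (t + s) := by
    filter_upwards [eventually_ge_atTop 0] with s hs
    apply ProbabilityMeasure.toMeasure_injective
    change (lam.map (T s)).map (T t) = lam.map (T (t + s))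
    rw [Measure.map_map (T t).continuous.measurable (T s).continuous.measurable,
      hTadd t s ht hs, ContinuousLinearMap.coe_comp]
  exact congrArg ProbabilityMeasure.toMeasure
    (tendsto_nhds_unique hshift (hmap.congr' heq))
end
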